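/- arXiv:1609.00951 — 3 statements merged into one kernel-verified Lean document; each statement's English description precedes it below -/
import Mathlib

section
/- Let F, K, N be positive integers. Let ℓ : ℝ^(F×K) × ℝ^(K×N) → ℝ be continuously differentiable on an open set containing the set of pairs of entrywise-nonnegative matrices. Let G₁ : ℝ^(F×K) × (ℝ^(F×K) × ℝ^(K×N)) → ℝ and G₂ : ℝ^(K×N) × (ℝ^(F×K) × ℝ^(K×N)) → ℝ be jointly continuous functions such that for every entrywise-nonnegative pair (W̃, H̃): (i) G₁(W̃ | W̃, H̃) = ℓ(W̃, H̃) and G₂(H̃ | W̃, H̃) = ℓ(W̃, H̃); (ii) G₁(W | W̃, H̃) ≥ ℓ(W, H̃) for all W ≥ 0 and G₂(H | W̃, H̃) ≥ ℓ(W̃, H) for all H ≥ 0; (iii) G₁(· | W̃, H̃) and G₂(· | W̃, H̃) are differentiable with ∇_W G₁(W | W̃, H̃)|_{W = W̃} = ∇_W ℓ(W, H̃)|_{W = W̃} and ∇_H G₂(H | W̃, H̃)|_{H = H̃} = ∇_H ℓ(W̃, H)|_{H = H̃}; (iv) G₁(· | W̃, H̃) and G₂(· | W̃, H̃) are strictly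 convex on the respective nonnegative orthants. Let (W⁰, H⁰) be an entrywise-nonnegative pair such that the sublevel set S₀ = {(W, H) : W ≥ 0, H ≥ 0, ℓ(W, H) ≤ ℓ(W⁰, H⁰)} is compact, and suppose the sequence {(Wᵗ, Hᵗ)} is generated by the alternating updates W^{t+1} = argmin over W ≥ 0 of G₁(W | Wᵗ, Hᵗ) and H^{t+1} = argmin over H ≥ 0 of G₂(H | W^{t+1}, Hᵗ), with these minimizers attained. Then the sequence {(Wᵗ, Hᵗ)} has at least one limit point, and every limit point (W̄, H̄) is a stationary point of the problem of minimizing ℓ over the nonnegative orthants, i.e., ⟨∇_W ℓ(W̄, H̄), W − W̄⟩ ≥ 0 for every W ≥ 0 and ⟨∇_H ℓ(W̄, H̄), H − H̄⟩ ≥ 0 for every H ≥ 0 (inner products are the Frobenius inner products). -/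
open Filter Topology

/-- First-order necessary condition for a minimizer over a convex set. -/
theorem fderiv_sub_nonneg_of_isMinOn {E : Type*} [NormedAddCommGroup E] [NormedSpace ℝ E]
    {f : E → ℝ} {s : Set E} {a x : E} (hs : Convex ℝ s) (ha : a ∈ s) (hx : x ∈ s)
    (hf : DifferentiableAt ℝ f a) (hmin : IsMinOn f s a) : 0 ≤ fderiv ℝ f a (x - a) :=
  hmin.localize.hasFDerivWithinAt_nonneg hf.hasFDerivAt.hasFDerivWithinAt
    (sub_mem_posTangentConeAt_of_segment_subset (hs.segment_subset ha hx))

theorem convex_setOf_entrywise_nonneg (m n : Type*) :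
    Convex ℝ {A : m → n → ℝ | ∀ i j, 0 ≤ A i j} :=
  convex_Ici (0 : m → n → ℝ)

theorem isClosed_setOf_entrywise_nonneg (m n : Type*) :
    IsClosed {A : m → n → ℝ | ∀ i j, 0 ≤ A i j} :=
  isClosed_Ici (a := (0 : m → n → ℝ))

/-- Convergence of the block majorization-minimization (multiplicative update) algorithm:
under the surrogate properties (P1), (P2), (P4), (P5) and compactness of the initial
sublevel set, the sequence of iterates has at least one limit point, and every limit point
is a stationary point of the problem of minimizing `ℓ` over the nonnegative orthants. -/
theorem stmt0
    (F K N : ℕ) (hF : 0 < F) (hK : 0 < K) (hN : 0 < N)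
    (ℓ : (Fin F → Fin K → ℝ) × (Fin K → Fin N → ℝ) → ℝ)
    (U : Set ((Fin F → Fin K → ℝ) × (Fin K → Fin N → ℝ)))
    (hUopen : IsOpen U)
    (hUsup : {p : (Fin F → Fin K → ℝ) × (Fin K → Fin N → ℝ) |
        (∀ i k, 0 ≤ p.1 i k) ∧ (∀ k j, 0 ≤ p.2 k j)} ⊆ U)
    (hℓ : ContDiffOn ℝ 1 ℓ U)
    (G₁ : (Fin F → Fin K → ℝ) → ((Fin F → Fin K → ℝ) × (Fin K → Fin N → ℝ)) → ℝ)
    (G₂ : (Fin K → Fin N → ℝ) → ((Fin F → Fin K → ℝ) × (Fin K → Fin N → ℝ)) → ℝ)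
    (hG₁cont : Continuous (fun q :
        (Fin F → Fin K → ℝ) × ((Fin F → Fin K → ℝ) × (Fin K → Fin N → ℝ)) => G₁ q.1 q.2))
    (hG₂cont : Continuous (fun q :
        (Fin K → Fin N → ℝ) × ((Fin F → Fin K → ℝ) × (Fin K → Fin N → ℝ)) => G₂ q.1 q.2))
    (hP1 : ∀ Wt Ht, (∀ i k, 0 ≤ Wt i k) → (∀ k j, 0 ≤ Ht k j) →
        G₁ Wt (Wt, Ht) = ℓ (Wt, Ht) ∧ G₂ Ht (Wt, Ht) = ℓ (Wt, Ht))
    (hP2 : ∀ Wt Ht, (∀ i k, 0 ≤ Wt i k) → (∀ k j, 0 ≤ Ht k j) →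
        (∀ W, (∀ i k, 0 ≤ W i k) → ℓ (W, Ht) ≤ G₁ W (Wt, Ht)) ∧
        (∀ H, (∀ k j, 0 ≤ H k j) → ℓ (Wt, H) ≤ G₂ H (Wt, Ht)))
    (hP4 : ∀ Wt Ht, (∀ i k, 0 ≤ Wt i k) → (∀ k j, 0 ≤ Ht k j) →
        (Differentiable ℝ fun W => G₁ W (Wt, Ht)) ∧
        (Differentiable ℝ fun H => G₂ H (Wt, Ht)) ∧
        fderiv ℝ (fun W => G₁ W (Wt, Ht)) Wt = fderiv ℝ (fun W => ℓ (W, Ht)) Wt ∧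
        fderiv ℝ (fun H => G₂ H (Wt, Ht)) Ht = fderiv ℝ (fun H => ℓ (Wt, H)) Ht)
    (hP5 : ∀ Wt Ht, (∀ i k, 0 ≤ Wt i k) → (∀ k j, 0 ≤ Ht k j) →
        StrictConvexOn ℝ {W : Fin F → Fin K → ℝ | ∀ i k, 0 ≤ W i k}
          (fun W => G₁ W (Wt, Ht)) ∧
        StrictConvexOn ℝ {H : Fin K → Fin N → ℝ | ∀ k j, 0 ≤ H k j}
          (fun H => G₂ H (Wt, Ht)))
    (W : ℕ → Fin F → Fin K → ℝ) (H : ℕ → Fin K → Fin N → ℝ)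
    (hW0 : ∀ i k, 0 ≤ W 0 i k) (hH0 : ∀ k j, 0 ≤ H 0 k j)
    (hS₀ : IsCompact {p : (Fin F → Fin K → ℝ) × (Fin K → Fin N → ℝ) |
        (∀ i k, 0 ≤ p.1 i k) ∧ (∀ k j, 0 ≤ p.2 k j) ∧ ℓ p ≤ ℓ (W 0, H 0)})
    (hWupd : ∀ t, (∀ i k, 0 ≤ W (t + 1) i k) ∧
        ∀ W', (∀ i k, 0 ≤ W' i k) → G₁ (W (t + 1)) (W t, H t) ≤ G₁ W' (W t, H t))
    (hHupd : ∀ t, (∀ k j, 0 ≤ H (t + 1) k j) ∧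
        ∀ H', (∀ k j, 0 ≤ H' k j) → G₂ (H (t + 1)) (W (t + 1), H t) ≤ G₂ H' (W (t + 1), H t)) :
    (∃ (Wb : Fin F → Fin K → ℝ) (Hb : Fin K → Fin N → ℝ) (φ : ℕ → ℕ), StrictMono φ ∧
        Tendsto (fun n => (W (φ n), H (φ n))) atTop (𝓝 (Wb, Hb))) ∧
    ∀ (Wb : Fin F → Fin K → ℝ) (Hb : Fin K → Fin N → ℝ),
      (∃ φ : ℕ → ℕ, StrictMono φ ∧
          Tendsto (fun n => (W (φ n), H (φ n))) atTop (𝓝 (Wb, Hb))) →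
      (∀ W', (∀ i k, 0 ≤ W' i k) → 0 ≤ fderiv ℝ (fun Wv => ℓ (Wv, Hb)) Wb (W' - Wb)) ∧
      (∀ H', (∀ k j, 0 ≤ H' k j) → 0 ≤ fderiv ℝ (fun Hv => ℓ (Wb, Hv)) Hb (H' - Hb)) := by
  have hW : ∀ t, ∀ i k, 0 ≤ W t i k := fun t => by
    cases t with
    | zero => exact hW0
    | succ t => exact (hWupd t).1
  have hH : ∀ t, ∀ k j, 0 ≤ H t k j := fun t => by
    cases t with
    | zero => exact hH0
    | succ t => exact (hHupd t).1
  have hG₁le : ∀ t, G₁ (W (t + 1)) (W t, H t) ≤ ℓ (W t, H t) := fun t =>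
    ((hWupd t).2 _ (hW t)).trans_eq (hP1 _ _ (hW t) (hH t)).1
  have hleG₁ : ∀ t, ℓ (W (t + 1), H t) ≤ G₁ (W (t + 1)) (W t, H t) := fun t =>
    (hP2 _ _ (hW t) (hH t)).1 _ (hW (t + 1))
  have hG₂le : ∀ t, G₂ (H (t + 1)) (W (t + 1), H t) ≤ ℓ (W (t + 1), H t) := fun t =>
    ((hHupd t).2 _ (hH t)).trans_eq (hP1 _ _ (hW (t + 1)) (hH t)).2
  have hleG₂ : ∀ t, ℓ (W (t + 1), H (t + 1)) ≤ G₂ (H (t + 1)) (W (t + 1), H t) := fun t =>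
    (hP2 _ _ (hW (t + 1)) (hH t)).2 _ (hH (t + 1))
  have hanti : Antitone fun t => ℓ (W t, H t) := antitone_nat_of_succ_le fun t =>
    (hleG₂ t).trans ((hG₂le t).trans ((hleG₁ t).trans (hG₁le t)))
  have hS : ∀ t, (W t, H t) ∈ {p : (Fin F → Fin K → ℝ) × (Fin K → Fin N → ℝ) |
      (∀ i k, 0 ≤ p.1 i k) ∧ (∀ k j, 0 ≤ p.2 k j) ∧ ℓ p ≤ ℓ (W 0, H 0)} :=
    fun t => ⟨hW t, hH t, hanti (Nat.zero_le t)⟩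
  refine ⟨?_, ?_⟩
  · obtain ⟨⟨Wb, Hb⟩, -, φ, hφ, hlim⟩ := hS₀.tendsto_subseq hS
    exact ⟨Wb, Hb, φ, hφ, hlim⟩
  rintro Wb Hb ⟨φ, hφ, hlim⟩
  have hWlim : Tendsto (fun n => W (φ n)) atTop (𝓝 Wb) := (continuous_fst.tendsto _).comp hlim
  have hHlim : Tendsto (fun n => H (φ n)) atTop (𝓝 Hb) := (continuous_snd.tendsto _).comp hlim
  have hWb : ∀ i k, 0 ≤ Wb i k := (isClosed_setOf_entrywise_nonneg _ _).mem_of_tendsto hWlim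
    (Eventually.of_forall fun n => hW (φ n))
  have hHb : ∀ k j, 0 ≤ Hb k j := (isClosed_setOf_entrywise_nonneg _ _).mem_of_tendsto hHlim
    (Eventually.of_forall fun n => hH (φ n))
  have hℓlim : Tendsto (fun t => ℓ (W t, H t)) atTop (𝓝 (ℓ (Wb, Hb))) := by
    refine (tendsto_iff_tendsto_subseq_of_antitone hanti hφ.tendsto_atTop).2 ?_
    have hc : ContinuousAt ℓ (Wb, Hb) :=
      hℓ.continuousOn.continuousAt (hUopen.mem_nhds (hUsup ⟨hWb, hHb⟩))
    exact hc.tendsto.comp hlim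
  have hℓlim' := (tendsto_add_atTop_iff_nat 1).2 hℓlim
  have hG₁lim : Tendsto (fun t => G₁ (W (t + 1)) (W t, H t)) atTop (𝓝 (ℓ (Wb, Hb))) :=
    tendsto_of_tendsto_of_tendsto_of_le_of_le hℓlim' hℓlim
      (fun t => (hleG₂ t).trans ((hG₂le t).trans (hleG₁ t))) hG₁le
  have hG₂lim : Tendsto (fun t => G₂ (H (t + 1)) (W (t + 1), H t)) atTop (𝓝 (ℓ (Wb, Hb))) :=
    tendsto_of_tendsto_of_tendsto_of_le_of_le hℓlim' hℓlim hleG₂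
      (fun t => (hG₂le t).trans ((hleG₁ t).trans (hG₁le t)))
  obtain ⟨hG₁diff, hG₂diff, hG₁fderiv, hG₂fderiv⟩ := hP4 Wb Hb hWb hHb
  have hmin₁ : IsMinOn (fun V => G₁ V (Wb, Hb)) {V : Fin F → Fin K → ℝ | ∀ i k, 0 ≤ V i k} Wb := by
    intro V hV
    refine (hP1 Wb Hb hWb hHb).1.trans_le ?_
    exact le_of_tendsto_of_tendsto' (hG₁lim.comp hφ.tendsto_atTop)
      ((hG₁cont.tendsto (V, (Wb, Hb))).comp (tendsto_const_nhds.prodMk_nhds hlim))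
      fun n => (hWupd (φ n)).2 V hV
  -- Strict convexity of `G₁` forces the updated first block to converge to the same limit.
  obtain ⟨⟨Ws, Hs⟩, -, ψ, hψ, hlim_succ⟩ := hS₀.tendsto_subseq fun n => hS (φ n + 1)
  have hWslim : Tendsto (fun n => W (φ (ψ n) + 1)) atTop (𝓝 Ws) :=
    (continuous_fst.tendsto _).comp hlim_succ
  have hφψ : Tendsto (fun n => φ (ψ n)) atTop atTop := hφ.tendsto_atTop.comp hψ.tendsto_atTop
  have hWs : ∀ i k, 0 ≤ Ws i k := (isClosed_setOf_entrywise_nonneg _ _).mem_of_tendsto hWslim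
    (Eventually.of_forall fun n => hW (φ (ψ n) + 1))
  have hG₁Ws : G₁ Ws (Wb, Hb) = G₁ Wb (Wb, Hb) := by
    refine Eq.trans ?_ (hP1 Wb Hb hWb hHb).1.symm
    exact tendsto_nhds_unique ((hG₁cont.tendsto (Ws, (Wb, Hb))).comp
      (hWslim.prodMk_nhds (hlim.comp hψ.tendsto_atTop))) (hG₁lim.comp hφψ)
  have hmin_s : IsMinOn (fun V => G₁ V (Wb, Hb)) {V : Fin F → Fin K → ℝ | ∀ i k, 0 ≤ V i k} Ws :=
    fun V hV => hG₁Ws.trans_le (hmin₁ hV)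
  obtain rfl : Ws = Wb := (hP5 Wb Hb hWb hHb).1.eq_of_isMinOn hmin_s hmin₁ hWs hWb
  have hmin₂ : IsMinOn (fun V => G₂ V (Ws, Hb)) {V : Fin K → Fin N → ℝ | ∀ k j, 0 ≤ V k j} Hb := by
    intro V hV
    refine (hP1 Ws Hb hWb hHb).2.trans_le ?_
    exact le_of_tendsto_of_tendsto' (hG₂lim.comp hφψ)
      ((hG₂cont.tendsto (V, (Ws, Hb))).comp (tendsto_const_nhds.prodMk_nhds
        (hWslim.prodMk_nhds (hHlim.comp hψ.tendsto_atTop))))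
      fun n => (hHupd (φ (ψ n))).2 V hV
  refine ⟨fun V hV => ?_, fun V hV => ?_⟩
  · rw [← hG₁fderiv]
    exact fderiv_sub_nonneg_of_isMinOn (convex_setOf_entrywise_nonneg _ _) hWb hV
      (hG₁diff Ws) hmin₁
  · rw [← hG₂fderiv]
    exact fderiv_sub_nonneg_of_isMinOn (convex_setOf_entrywise_nonneg _ _) hHb hV
      (hG₂diff Hb) hmin₂
end

section
/- Define h(σ, t) = (σ^t − 1)/t for t ≠ 0 and h(σ, 0) = log σ, for σ > 0, extended by h(0, t) = −1/t for t > 0 so that h(·, t) is continuous at 0 for t > 0. Let λ₁ > 0, λ₂ ≥ 0, and let ϑ₂ be any real number with ϑ₂ ≥ 1 if λ₂ = 0 and ϑ₂ ≥ 2 if λ₂ > 0. Let W ∈ ℝ^(F×K) with W ≥ 0 entrywise and W̃ ∈ ℝ^(F×K) with W̃ > 0 entrywise. Then λ₁‖W‖₁,₁ + λ₂‖W‖_F² ≤ Σ_{i=1}^F Σ_{k=1}^K (λ₁ w̃ᵢₖ + 2λ₂ w̃ᵢₖ²) · h(wᵢₖ / w̃ᵢₖ, ϑ₂) + λ₁‖W̃‖₁,₁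 + λ₂‖W̃‖_F², with equality when W = W̃. -/
open scoped BigOperators

/-- The function `h(σ, t) = (σ^t − 1)/t` for `t ≠ 0` and `h(σ, 0) = log σ`.
Note that for `t > 0` we have `(0 : ℝ) ^ t = 0` (real power), so `h 0 t = −1/t`,
which is precisely the continuous extension of `h(·, t)` to `σ = 0` for `t > 0`. -/
noncomputable def h (σ t : ℝ) : ℝ := if t = 0 then Real.log σ else (σ ^ t - 1) / t

theorem h_mono_right {σ s t : ℝ} (hσ : 0 ≤ σ) (hs : 0 < s) (hst : s ≤ t) : h σ s ≤ h σ t := by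
  have ht : 0 < t := hs.trans_le hst
  have hB := one_add_mul_self_le_rpow_one_add (s := σ ^ s - 1)
    (by linarith [Real.rpow_nonneg hσ s]) ((one_le_div hs).2 hst)
  have hpow : (1 + (σ ^ s - 1)) ^ (t / s) = σ ^ t := by
    rw [add_sub_cancel, ← Real.rpow_mul hσ, mul_div_cancel₀ _ hs.ne']
  rw [hpow] at hB
  rw [h, h, if_neg hs.ne', if_neg ht.ne', le_div_iff₀ ht]
  calc (σ ^ s - 1) / s * t = t / s * (σ ^ s - 1) := by ring
    _ ≤ σ ^ t - 1 := by linarith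

theorem h_one_left (t : ℝ) : h 1 t = 0 := by simp [h]

theorem h_one_right (σ : ℝ) : h σ 1 = σ - 1 := by simp [h]

theorem h_two_right (σ : ℝ) : h σ 2 = (σ ^ 2 - 1) / 2 := by simp [h]

theorem elasticNet_entry_le {l₁ l₂ t w v : ℝ} (hl₁ : 0 < l₁) (hl₂ : 0 ≤ l₂)
    (hta : l₂ = 0 → 1 ≤ t) (htb : 0 < l₂ → 2 ≤ t) (hw : 0 ≤ w) (hv : 0 < v) :
    l₁ * |w| + l₂ * w ^ 2 ≤
      (l₁ * v + 2 * l₂ * v ^ 2) * h (w / v) t + l₁ * |v| + l₂ * v ^ 2 := by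
  have hσ : 0 ≤ w / v := div_nonneg hw hv.le
  have ht : 1 ≤ t := by
    rcases hl₂.eq_or_lt with h0 | hpos
    · exact hta h0.symm
    · linarith [htb hpos]
  have hlin : l₁ * v * (w / v - 1) ≤ l₁ * v * h (w / v) t := by
    rw [← h_one_right]
    gcongr
    exact h_mono_right hσ one_pos ht
  have hquad : 2 * l₂ * v ^ 2 * (((w / v) ^ 2 - 1) / 2) ≤ 2 * l₂ * v ^ 2 * h (w / v) t := by
    rcases hl₂.eq_or_lt with rfl | hpos
    · simp
    · rw [← h_two_right]
      gcongr
      exact h_mono_right hσ two_pos (htb hpos)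
  have hlin' : l₁ * v * (w / v - 1) = l₁ * w - l₁ * v := by field_simp
  have hquad' : 2 * l₂ * v ^ 2 * (((w / v) ^ 2 - 1) / 2) = l₂ * w ^ 2 - l₂ * v ^ 2 := by
    field_simp
  rw [abs_of_nonneg hw, abs_of_pos hv]
  linarith

/-- Majorization of the elastic-net regularizer: for `λ₁ > 0`, `λ₂ ≥ 0`, `ϑ₂ ≥ 1`
(and `ϑ₂ ≥ 2` if `λ₂ > 0`), `W ≥ 0` entrywise and `W̃ > 0` entrywise,
`λ₁‖W‖₁,₁ + λ₂‖W‖_F² ≤ Σᵢₖ (λ₁ w̃ᵢₖ + 2λ₂ w̃ᵢₖ²) h(wᵢₖ/w̃ᵢₖ, ϑ₂) + λ₁‖W̃‖₁,₁ + λ₂‖W̃‖_F²`,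
with equality when `W = W̃`. -/
theorem stmt13 (F K : ℕ) (l₁ l₂ : ℝ) (hl₁ : 0 < l₁) (hl₂ : 0 ≤ l₂)
    (ϑ₂ : ℝ) (hϑa : l₂ = 0 → 1 ≤ ϑ₂) (hϑb : 0 < l₂ → 2 ≤ ϑ₂)
    (W Wt : Fin F → Fin K → ℝ) (hW : ∀ i k, 0 ≤ W i k) (hWt : ∀ i k, 0 < Wt i k) :
    l₁ * (∑ i, ∑ k, |W i k|) + l₂ * (∑ i, ∑ k, (W i k) ^ 2) ≤
      (∑ i, ∑ k, (l₁ * Wt i k + 2 * l₂ * (Wt i k) ^ 2) * h (W i k / Wt i k) ϑ₂)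
        + l₁ * (∑ i, ∑ k, |Wt i k|) + l₂ * (∑ i, ∑ k, (Wt i k) ^ 2) ∧
    (W = Wt →
      l₁ * (∑ i, ∑ k, |W i k|) + l₂ * (∑ i, ∑ k, (W i k) ^ 2) =
        (∑ i, ∑ k, (l₁ * Wt i k + 2 * l₂ * (Wt i k) ^ 2) * h (W i k / Wt i k) ϑ₂)
          + l₁ * (∑ i, ∑ k, |Wt i k|) + l₂ * (∑ i, ∑ k, (Wt i k) ^ 2)) := by
  constructor
  · simp only [Finset.mul_sum, ← Finset.sum_add_distrib]
    exact Finset.sum_le_sum fun i _ => Finset.sum_le_sum fun k _ =>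
      elasticNet_entry_le hl₁ hl₂ hϑa hϑb (hW i k) (hWt i k)
  · rintro rfl
    simp [div_self (hWt _ _).ne', h_one_left]
end

section
/- Define h(σ, t) = (σ^t − 1)/t for t ≠ 0 and h(σ, 0) = log σ, for σ > 0. Let s⁺ ≥ 0, s⁻ > 0, w̃ > 0, λ₁ > 0, λ₂ ≥ 0 be real numbers, and let ϑ₁, ϑ₂ ∈ ℝ satisfy ϑ₁ ≤ 1 ≤ ϑ₂ and ϑ₁ < ϑ₂. Define g : (0, ∞) → ℝ by g(w) = (s⁺ + λ₁) w̃ h(w/w̃, ϑ₂) + 2λ₂ w̃² h(w/w̃, ϑ₂) − s⁻ w̃ h(w/w̃, ϑ₁). Then g attains its minimum over (0, ∞) at the unique point w* = w̃ · ( s⁻ / (s⁺ + 2λ₂ w̃ + λ₁) )^{1/(ϑ₂ − ϑ₁)}, and w* is the unique zero of g' on (0, ∞). -/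
theorem hasDerivAt_h {σ : ℝ} (hσ : 0 < σ) (t : ℝ) :
    HasDerivAt (fun x => h x t) (σ ^ (t - 1)) σ := by
  by_cases ht : t = 0
  · subst ht
    simpa [h, Real.rpow_neg_one] using Real.hasDerivAt_log hσ.ne'
  · have := ((Real.hasDerivAt_rpow_const (x := σ) (p := t) (Or.inl hσ.ne')).sub_const 1).div_const t
    rw [mul_div_cancel_left₀ _ ht] at this
    simpa [h, ht] using this

theorem hasDerivAt_const_mul_h_div {c w : ℝ} (hc : 0 < c) (hw : 0 < w) (t : ℝ) :
    HasDerivAt (fun x => c * h (x / c) t) ((w / c) ^ (t - 1)) w := by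
  have := (((hasDerivAt_h (div_pos hw hc) t).comp w ((hasDerivAt_id w).div_const c)).const_mul c)
  refine this.congr_deriv ?_
  field_simp

/-- A function on `(0, ∞)` whose derivative is negative before `a` and positive after `a` is
strictly larger than its value at `a` everywhere else. -/
theorem lt_of_deriv_neg_of_deriv_pos {f : ℝ → ℝ} {a : ℝ} (ha : 0 < a)
    (hf : ContinuousOn f (Set.Ioi 0)) (hneg : ∀ x, 0 < x → x < a → deriv f x < 0)
    (hpos : ∀ x, a < x → 0 < deriv f x) {x : ℝ} (hx : 0 < x) (hxa : x ≠ a) : f a < f x := by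
  rcases hxa.lt_or_gt with hlt | hgt
  · refine strictAntiOn_of_deriv_neg (convex_Icc x a)
      (hf.mono fun y hy => hx.trans_le hy.1) (fun y hy => ?_)
      (Set.left_mem_Icc.2 hlt.le) (Set.right_mem_Icc.2 hlt.le) hlt
    rw [interior_Icc] at hy
    exact hneg y (hx.trans hy.1) hy.2
  · refine strictMonoOn_of_deriv_pos (convex_Ici a)
      (hf.mono fun y hy => ha.trans_le hy) (fun y hy => ?_) Set.self_mem_Ici hgt.le hgt
    rw [interior_Ici] at hy
    exact hpos y hy

/-- The multiplicative update rule as the unique minimizer of the entrywise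
first-order surrogate: `g(w) = (s⁺ + λ₁) w̃ h(w/w̃, ϑ₂) + 2λ₂ w̃² h(w/w̃, ϑ₂) −
s⁻ w̃ h(w/w̃, ϑ₁)` attains its minimum over `(0, ∞)` at the unique point
`w* = w̃ (s⁻/(s⁺ + 2λ₂ w̃ + λ₁))^(1/(ϑ₂−ϑ₁))`, which is also the unique zero of `g'`
on `(0, ∞)`. -/
theorem stmt16 (sp sm wt l₁ l₂ : ℝ) (hsp : 0 ≤ sp) (hsm : 0 < sm) (hwt : 0 < wt)
    (hl₁ : 0 < l₁) (hl₂ : 0 ≤ l₂)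
    (ϑ₁ ϑ₂ : ℝ) (hϑ₁ : ϑ₁ ≤ 1) (hϑ₂ : 1 ≤ ϑ₂) (hϑ : ϑ₁ < ϑ₂)
    (g : ℝ → ℝ)
    (hg : g = fun w => (sp + l₁) * wt * h (w / wt) ϑ₂ + 2 * l₂ * wt ^ 2 * h (w / wt) ϑ₂
        - sm * wt * h (w / wt) ϑ₁)
    (ws : ℝ) (hws : ws = wt * (sm / (sp + 2 * l₂ * wt + l₁)) ^ (1 / (ϑ₂ - ϑ₁))) :
    ws ∈ Set.Ioi (0 : ℝ) ∧
    (∀ w ∈ Set.Ioi (0 : ℝ), g ws ≤ g w) ∧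
    (∀ w ∈ Set.Ioi (0 : ℝ), (∀ w' ∈ Set.Ioi (0 : ℝ), g w ≤ g w') → w = ws) ∧
    deriv g ws = 0 ∧
    (∀ w ∈ Set.Ioi (0 : ℝ), deriv g w = 0 → w = ws) := by
  have ha : 0 < sp + 2 * l₂ * wt + l₁ := by positivity
  have hd : 0 < ϑ₂ - ϑ₁ := sub_pos.2 hϑ
  have hq : 0 < sm / (sp + 2 * l₂ * wt + l₁) := div_pos hsm ha
  have hws_pos : 0 < ws := hws ▸ mul_pos hwt (Real.rpow_pos_of_pos hq _)
  have hsm_eq : sm = (sp + 2 * l₂ * wt + l₁) * (ws / wt) ^ (ϑ₂ - ϑ₁) := by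
    rw [hws, mul_div_cancel_left₀ _ hwt.ne', ← Real.rpow_mul hq.le,
      one_div_mul_cancel hd.ne', Real.rpow_one, mul_div_cancel₀ _ ha.ne']
  have hderiv : ∀ w, 0 < w → HasDerivAt g ((w / wt) ^ (ϑ₁ - 1) * (sp + 2 * l₂ * wt + l₁) *
      ((w / wt) ^ (ϑ₂ - ϑ₁) - (ws / wt) ^ (ϑ₂ - ϑ₁))) w := by
    intro w hw
    have key := ((hasDerivAt_const_mul_h_div hwt hw ϑ₂).const_mul (sp + 2 * l₂ * wt + l₁)).sub
      ((hasDerivAt_const_mul_h_div hwt hw ϑ₁).const_mul sm)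
    have hsplit : (w / wt) ^ (ϑ₂ - 1) = (w / wt) ^ (ϑ₁ - 1) * (w / wt) ^ (ϑ₂ - ϑ₁) := by
      rw [← Real.rpow_add (div_pos hw hwt)]
      congr 1
      ring
    have hg' : g = (fun x => (sp + 2 * l₂ * wt + l₁) * (wt * h (x / wt) ϑ₂)) -
        fun x => sm * (wt * h (x / wt) ϑ₁) := by
      rw [hg]
      funext x
      simp only [Pi.sub_apply]
      ring
    rw [hg']
    refine key.congr_deriv ?_
    rw [hsplit]
    linear_combination -(w / wt) ^ (ϑ₁ - 1) * hsm_eq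
  have hneg : ∀ w, 0 < w → w < ws → deriv g w < 0 := by
    intro w hw hlt
    rw [(hderiv w hw).deriv]
    have hσ : 0 < w / wt := div_pos hw hwt
    exact mul_neg_of_pos_of_neg (by positivity) (sub_neg.2 (Real.rpow_lt_rpow hσ.le
      (div_lt_div_of_pos_right hlt hwt) hd))
  have hpos : ∀ w, ws < w → 0 < deriv g w := by
    intro w hlt
    have hw := hws_pos.trans hlt
    rw [(hderiv w hw).deriv]
    have hσ : 0 < w / wt := div_pos hw hwt
    exact mul_pos (by positivity) (sub_pos.2 (Real.rpow_lt_rpow (div_pos hws_pos hwt).le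
      (div_lt_div_of_pos_right hlt hwt) hd))
  have hmin : ∀ w, 0 < w → w ≠ ws → g ws < g w := fun w hw hne =>
    lt_of_deriv_neg_of_deriv_pos hws_pos
      (fun x hx => (hderiv x hx).continuousAt.continuousWithinAt) hneg hpos hw hne
  refine ⟨hws_pos, fun w hw => ?_, fun w hw hle => ?_, ?_, fun w hw h0 => ?_⟩
  · rcases eq_or_ne w ws with rfl | hne
    · exact le_rfl
    · exact (hmin w hw hne).le
  · by_contra hne
    exact (hle ws hws_pos).not_gt (hmin w hw hne)
  · rw [(hderiv ws hws_pos).deriv, sub_self, mul_zero]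
  · by_contra hne
    rcases lt_or_gt_of_ne hne with hlt | hgt
    · exact (hneg w hw hlt).ne h0
    · exact (hpos w hgt).ne' h0
end
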